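/- arXiv:2208.12046 — 3 statements merged into one kernel-verified Lean document; each statement's English description precedes it below -/
import Mathlib

section
/- Let S be a nonempty finite subset of the index type, let m be an index with m ∉ S, and suppose ‖Δ n‖ ≤ A for every n ∈ S ∪ {m}. Then ‖f(S ∪ {m}) − f(S)‖ ≤ 2A / (|S| + 1). -/
/-- **Sharper intermediate sensitivity bound from the proof of the paper's
Theorem 1.**  Under the hypotheses of the sensitivity bound,
`‖f (S ∪ {m}) − f S‖ ≤ 2A / (|S| + 1)`. -/
theorem sensitivity_bound_sharp {E : Type*} [NormedAddCommGroup E] [NormedSpace ℝ E]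
    {ι : Type*} [DecidableEq ι] (Δ : ι → E) (A : ℝ) (hA : 0 < A)
    (S : Finset ι) (hS : S.Nonempty) (m : ι) (hm : m ∉ S)
    (hbound : ∀ n ∈ insert m S, ‖Δ n‖ ≤ A) :
    ‖(((insert m S).card : ℝ))⁻¹ • ∑ n ∈ insert m S, Δ n
        - ((S.card : ℝ))⁻¹ • ∑ n ∈ S, Δ n‖ ≤ 2 * A / ((S.card : ℝ) + 1) := by
  have hk : (0 : ℝ) < (S.card : ℝ) := by exact_mod_cast hS.card_pos
  have hsum : ‖∑ n ∈ S, Δ n‖ ≤ (S.card : ℝ) * A := by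
    have h := norm_sum_le_of_le S (fun n hn => hbound n (Finset.mem_insert_of_mem hn))
    simpa using h
  have hmA : ‖Δ m‖ ≤ A := hbound m (Finset.mem_insert_self m S)
  rw [Finset.card_insert_of_notMem hm, Finset.sum_insert hm]
  push_cast
  generalize (∑ n ∈ S, Δ n) = s at *
  generalize (S.card : ℝ) = k at *
  have hk1 : 0 < k + 1 := by linarith
  have key : (k + 1)⁻¹ • (Δ m + s) - k⁻¹ • s = (k + 1)⁻¹ • (Δ m - k⁻¹ • s) := by
    have hc : k⁻¹ = (k + 1)⁻¹ + (k + 1)⁻¹ * k⁻¹ := by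
      field_simp
    rw [smul_add, smul_sub, smul_smul]
    nth_rewrite 1 [hc]
    rw [add_smul]
    abel
  have havg : ‖k⁻¹ • s‖ ≤ A := by
    rw [norm_smul, Real.norm_of_nonneg (inv_nonneg.mpr hk.le), inv_mul_le_iff₀ hk]
    exact hsum
  have hd : ‖Δ m - k⁻¹ • s‖ ≤ 2 * A := by
    have := norm_sub_le (Δ m) (k⁻¹ • s)
    linarith
  rw [key, norm_smul, Real.norm_of_nonneg (inv_nonneg.mpr hk1.le), inv_mul_eq_div]
  gcongr
end

section
/- Let P be a partition of a finite set M, let m ∈ B_l with B_l ∈ P, and let B_k be a target block with B_k ≠ B_l, where either B_k ∈ P or B_k = ∅. Let P' = ((P \ {B_l, B_k}) ∪ {B_l \ {m}, B_k ∪ {m}}) \ {∅} be the partition resulting from the switch operation Φ_{l,k}(m). If the switch gain Ω = (U(B_k ∪ {m}) − U(B_k)) − (U(B_l) − U(B_l \ {m})) is strictly positive, then W(P') > W(P); that is, a switch operation with strictly positive gain strictly improves the social welfare. -/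
/-- **Paper's Lemma 1.**  A switch operation with strictly positive switch gain
strictly improves the social welfare: under the partition hypotheses, if
`Ω = (U(Bk ∪ {m}) − U(Bk)) − (U(Bl) − U(Bl \ {m})) > 0` then `W(P') > W(P)`
for `P' = ((P \ {Bl, Bk}) ∪ {Bl \ {m}, Bk ∪ {m}}) \ {∅}`. -/
theorem switch_improves_welfare {ι : Type*} [DecidableEq ι]
    (M : Finset ι) (U : Finset ι → ℝ) (hU : U ∅ = 0)
    (P : Finset (Finset ι))
    (hne : ∀ B ∈ P, B ≠ ∅)
    (hdisj : ∀ B ∈ P, ∀ B' ∈ P, B ≠ B' → Disjoint B B')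
    (hcover : P.sup id = M)
    (Bl Bk : Finset ι) (hBl : Bl ∈ P) (m : ι) (hm : m ∈ Bl)
    (hBk : Bk ∈ P ∨ Bk = ∅) (hkl : Bk ≠ Bl)
    (hgain : 0 < (U (Bk ∪ {m}) - U Bk) - (U Bl - U (Bl \ {m}))) :
    (∑ B ∈ P, U B)
      < ∑ B ∈ ((P \ {Bl, Bk}) ∪ {Bl \ {m}, Bk ∪ {m}}) \ {∅}, U B := by
  have h1 : ∀ S : Finset (Finset ι), ∑ B ∈ S \ {∅}, U B = ∑ B ∈ S, U B := by
    intro S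
    apply Finset.sum_subset Finset.sdiff_subset
    intro x hx hx'
    have : x = ∅ := by
      by_contra h
      exact hx' (by simp [hx, h])
    rw [this, hU]
  have hmeet : ∀ B ∈ P, ∀ x ∈ B, x ∈ Bl → B = Bl := by
    intro B hB x hx hxl
    by_contra h
    exact Finset.disjoint_left.mp (hdisj B hB Bl hBl h) hx hxl
  have hd : Disjoint (P \ {Bl, Bk}) {Bl \ {m}, Bk ∪ {m}} := by
    rw [Finset.disjoint_left]
    intro B hB hB'
    simp only [Finset.mem_sdiff, Finset.mem_insert, Finset.mem_singleton, not_or] at hB hB'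
    obtain ⟨hBP, hB1, hB2⟩ := hB
    rcases hB' with h | h
    · obtain ⟨x, hx⟩ := Finset.nonempty_iff_ne_empty.mpr (hne B hBP)
      have hx2 := hx
      rw [h] at hx2
      exact hB1 (hmeet B hBP x hx (Finset.mem_sdiff.mp hx2).1)
    · exact hB1 (hmeet B hBP m (by simp [h]) hm)
  have hne2 : Bl \ {m} ≠ Bk ∪ {m} := by
    intro h
    have : m ∈ Bl \ {m} := by rw [h]; simp
    simp at this
  have h2 : ∑ B ∈ P, U B = ∑ B ∈ P \ {Bl, Bk}, U B + (U Bl + U Bk) := by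
    rw [← Finset.sum_pair (Ne.symm hkl), ← Finset.sum_union Finset.sdiff_disjoint,
      Finset.sdiff_union_self_eq_union]
    apply Finset.sum_subset Finset.subset_union_left
    intro x hx hx'
    simp only [Finset.mem_union, Finset.mem_insert, Finset.mem_singleton] at hx
    rcases hx with h | h | h
    · exact absurd h hx'
    · exact absurd (h ▸ hBl) hx'
    · rcases hBk with hk | hk
      · exact absurd (h ▸ hk) hx'
      · rw [h, hk, hU]
  rw [h1, Finset.sum_union hd, Finset.sum_pair hne2, h2]
  linarith
end

section
/- Let P be a partition of a finite set M that is Nash-stable, i.e., for every miner m ∈ M with current block B_l ∈ P and every target block B_k ∈ (P \ {B_l}) ∪ {∅}, the switch gain Ω_m(Φ_{l,k}) = (U(B_k ∪ {m}) − U(B_k)) − (U(B_l) − U(B_l \ {m})) satisfies Ω_m(Φ_{l,k}) ≤ 0. Then P is a local maximum of the social welfare with respect to single switch operations: for every partition P' = ((P \ {B_l, B_k}) ∪ {B_l \ {m}, B_k ∪ {m}}) \ {∅} obtained from P by a single switch operation, W(P') ≤ W(P). -/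
/-- **Nash-stability implies local welfare maximality (paper's Definition 9 and
Theorem 3).**  If a partition `P` of `M` is Nash-stable, i.e. every switch gain
`Ω_m(Φ_{l,k}) = (U(Bk ∪ {m}) − U(Bk)) − (U(Bl) − U(Bl \ {m}))` for `m ∈ Bl ∈ P`
and `Bk ∈ (P \ {Bl}) ∪ {∅}` is nonpositive, then no single switch operation can
increase the social welfare: every partition
`P' = ((P \ {Bl, Bk}) ∪ {Bl \ {m}, Bk ∪ {m}}) \ {∅}` obtained from `P` by a
single switch operation satisfies `W(P') ≤ W(P)`. -/
theorem nash_stable_local_max {ι : Type*} [DecidableEq ι]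
    (M : Finset ι) (U : Finset ι → ℝ) (hU : U ∅ = 0)
    (P : Finset (Finset ι))
    (hne : ∀ B ∈ P, B ≠ ∅)
    (hdisj : ∀ B ∈ P, ∀ B' ∈ P, B ≠ B' → Disjoint B B')
    (hcover : P.sup id = M)
    (hstable : ∀ m : ι, ∀ Bl ∈ P, m ∈ Bl →
      ∀ Bk, (Bk ∈ P \ {Bl} ∨ Bk = ∅) →
        (U (Bk ∪ {m}) - U Bk) - (U Bl - U (Bl \ {m})) ≤ 0) :
    ∀ Bl ∈ P, ∀ m ∈ Bl, ∀ Bk, (Bk ∈ P ∨ Bk = ∅) → Bk ≠ Bl →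
      (∑ B ∈ ((P \ {Bl, Bk}) ∪ {Bl \ {m}, Bk ∪ {m}}) \ {∅}, U B)
        ≤ ∑ B ∈ P, U B := by
  intro Bl hBl m hm Bk hBk hne'
  have key := hstable m Bl hBl hm Bk (by
    rcases hBk with h | h
    · left; simp [h, hne']
    · right; exact h)
  have h1 : (∑ B ∈ ((P \ {Bl, Bk}) ∪ {Bl \ {m}, Bk ∪ {m}}) \ {∅}, U B)
      = ∑ B ∈ (P \ {Bl, Bk}) ∪ {Bl \ {m}, Bk ∪ {m}}, U B := by
    apply Finset.sum_subset Finset.sdiff_subset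
    intro x hx hx'
    have : x = ∅ := by
      by_contra h
      exact hx' (by rw [Finset.mem_sdiff]; exact ⟨hx, by simpa using h⟩)
    rw [this, hU]
  have hab : Bl \ {m} ≠ Bk ∪ {m} := by
    intro h
    have : m ∈ Bl \ {m} := by rw [h]; simp
    simp at this
  have hd : Disjoint (P \ {Bl, Bk}) {Bl \ {m}, Bk ∪ {m}} := by
    rw [Finset.disjoint_left]
    intro x hx hx'
    simp only [Finset.mem_sdiff, Finset.mem_insert, Finset.mem_singleton, not_or] at hx hx'
    obtain ⟨hxP, hxl, hxk⟩ := hx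
    have hdx := hdisj x hxP Bl hBl hxl
    rcases hx' with h | h
    · apply hne x hxP
      have hsub : x ⊆ Bl := by rw [h]; exact Finset.sdiff_subset
      exact Finset.disjoint_self_iff_empty x |>.mp (hdx.mono_right hsub)
    · exact Finset.disjoint_left.mp hdx (by rw [h]; simp) hm
  have h2 : ∑ B ∈ P, U B = ∑ B ∈ P \ {Bl, Bk}, U B + (U Bl + U Bk) := by
    rcases hBk with h | h
    · rw [← Finset.sum_pair (f := U) hne'.symm]
      refine (Finset.sum_sdiff ?_).symm
      intro x hx
      simp only [Finset.mem_insert, Finset.mem_singleton] at hx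
      rcases hx with rfl | rfl <;> assumption
    · have h3 : P \ {Bl, Bk} = P \ {Bl} := by
        ext x
        simp only [Finset.mem_sdiff, Finset.mem_insert, Finset.mem_singleton, not_or]
        constructor
        · exact fun hx => ⟨hx.1, hx.2.1⟩
        · exact fun hx => ⟨hx.1, hx.2, by rw [h]; exact hne x hx.1⟩
      rw [h3, h, hU, add_zero, ← Finset.sum_singleton U Bl]
      exact (Finset.sum_sdiff (by simpa using hBl)).symm
  rw [h1, Finset.sum_union hd, Finset.sum_pair hab, h2]
  linarith
end
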